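/- Let B_n be distributed as Beta_p(a_n, a_n) with a_n = a_0 + a·n (a_0, a > 0), i.e. with density proportional to det(X)^{a_n − p} det(I_p − X)^{a_n − p} on Hermitian matrices 0 < X < I_p. Then (B_n) satisfies a large deviation principle with speed n and good rate function I(B) = −a log det(B − B^2) − 2ap log 2 for 0_p < B < I_p, and I(B) = +∞ otherwise. -/

import Mathlib

open MeasureTheory Filter
open scoped ComplexOrder ENNReal Topology

attribute [local instance] Classical.propDecidable

noncomputable instance matrixMeasureSpace (p : ℕ) : MeasureSpace (Matrix (Fin p) (Fin p) ℂ) :=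
  inferInstanceAs (MeasureSpace (Fin p → Fin p → ℂ))

/-- Parametrization of Hermitian matrices by their diagonal (real) entries and their
strictly upper triangular (complex) entries. -/
noncomputable def hermMk (p : ℕ)
    (x : (Fin p → ℝ) × ({q : Fin p × Fin p // q.1 < q.2} → ℂ)) :
    Matrix (Fin p) (Fin p) ℂ :=
  Matrix.of fun i j =>
    if h : i < j then x.2 ⟨(i, j), h⟩
    else if h' : j < i then star (x.2 ⟨(j, i), h'⟩)
    else (x.1 i : ℂ)

/-- Lebesgue measure `∏_{i ≤ j} dx_{ij}^Re ∏_{i < j} dx_{ij}^Im` on the set of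
Hermitian `p × p` complex matrices. -/
noncomputable def hermLebesgue (p : ℕ) : Measure (Matrix (Fin p) (Fin p) ℂ) :=
  Measure.map (hermMk p) volume

/-- Normalization of a measure into a probability measure. -/
noncomputable def mnormalize {α : Type*} [MeasurableSpace α] (μ : Measure α) : Measure α :=
  (μ Set.univ)⁻¹ • μ

/-- The complex matrix Beta distribution `Beta_p(α, β)`, with density proportional to
`det(X)^(α-p) det(I-X)^(β-p)` on Hermitian matrices `0 < X < I`. -/
noncomputable def matrixBeta (p : ℕ) (α β : ℝ) : Measure (Matrix (Fin p) (Fin p) ℂ) :=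
  mnormalize <| (hermLebesgue p).withDensity fun X =>
    if X.PosDef ∧ ((1 : Matrix (Fin p) (Fin p) ℂ) - X).PosDef then
      ENNReal.ofReal (Real.rpow X.det.re (α - p) * Real.rpow (1 - X).det.re (β - p))
    else 0

/-- The complex Wishart distribution `W_p(a)`, with density proportional to
`det(X)^(a-p) e^(-tr X)` on positive definite Hermitian matrices. -/
noncomputable def wishart (p : ℕ) (a : ℝ) : Measure (Matrix (Fin p) (Fin p) ℂ) :=
  mnormalize <| (hermLebesgue p).withDensity fun X =>
    if X.PosDef then
      ENNReal.ofReal (Real.rpow X.det.re (a - p) * Real.exp (-X.trace.re))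
    else 0

/-- The Gaussian Unitary Ensemble `GUE_p`, with density proportional to `exp(-tr(X²)/2)`
on Hermitian matrices. -/
noncomputable def gue (p : ℕ) : Measure (Matrix (Fin p) (Fin p) ℂ) :=
  mnormalize <| (hermLebesgue p).withDensity fun X =>
    ENNReal.ofReal (Real.exp (-(X * X).trace.re / 2))

/-- Convergence in distribution of a sequence of laws to a limiting law. -/
def TendstoInDistribution {M : Type*} [MeasurableSpace M] [TopologicalSpace M]
    (μ : ℕ → Measure M) (ν : Measure M) : Prop :=
  ∀ f : BoundedContinuousFunction M ℝ,
    Tendsto (fun n => ∫ x, f x ∂(μ n)) atTop (𝓝 (∫ x, f x ∂ν))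

/-- A sequence of measures satisfies a large deviation principle with speed `n` and good
rate function `I`: `I` is lower semicontinuous with compact sublevel sets, and for every
Borel set `A`,
`-inf_{Int A} I ≤ liminf (1/n) log μ_n(A) ≤ limsup (1/n) log μ_n(A) ≤ -inf_{Clo A} I`. -/
def IsLDP {α : Type*} [TopologicalSpace α] [MeasurableSpace α]
    (μ : ℕ → Measure α) (I : α → EReal) : Prop :=
  LowerSemicontinuous I ∧ (∀ c : ℝ, IsCompact {x | I x ≤ (c : EReal)}) ∧
  ∀ A : Set α, MeasurableSet A →
    (-(⨅ x ∈ interior A, I x) ≤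
        liminf (fun n : ℕ => (((n : ℝ)⁻¹ : ℝ) : EReal) * (μ n A).log) atTop ∧
      limsup (fun n : ℕ => (((n : ℝ)⁻¹ : ℝ) : EReal) * (μ n A).log) atTop ≤
        -(⨅ x ∈ closure A, I x))

section LaplacePrinciple

variable {α : Type*} [MeasurableSpace α]

/-- The density `e^{b g}` on `S`, extended by zero. -/
noncomputable def expDensity (S : Set α) (g : α → ℝ) (b : ℝ) (x : α) : ℝ≥0∞ :=
  if x ∈ S then ENNReal.ofReal (Real.exp (b * g x)) else 0

lemma ENNReal.exists_eq_ofReal_exp {m : ℝ≥0∞} (h0 : m ≠ 0) (ht : m ≠ ⊤) :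
    ∃ k : ℝ, m = ENNReal.ofReal (Real.exp k) :=
  ⟨Real.log m.toReal, by
    rw [Real.exp_log (ENNReal.toReal_pos h0 ht), ENNReal.ofReal_toReal ht]⟩

lemma withDensity_expDensity_le {μ : Measure α} {S A : Set α} {g : α → ℝ} {b c : ℝ}
    (hA : MeasurableSet A) (hb : 0 ≤ b) (hc : ∀ x ∈ A, x ∈ S → g x ≤ c) :
    μ.withDensity (expDensity S g b) A ≤ μ S * ENNReal.ofReal (Real.exp (b * c)) := by
  rw [withDensity_apply _ hA]
  calc ∫⁻ x in A, expDensity S g b x ∂μ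
      ≤ ∫⁻ x in A, S.indicator (fun _ => ENNReal.ofReal (Real.exp (b * c))) x ∂μ := by
        refine setLIntegral_mono' hA fun x hx => ?_
        by_cases hS : x ∈ S
        · simp only [expDensity, if_pos hS, Set.indicator_of_mem hS]
          gcongr
          exact hc x hx hS
        · simp [expDensity, hS]
    _ ≤ ∫⁻ x, S.indicator (fun _ => ENNReal.ofReal (Real.exp (b * c))) x ∂μ :=
        setLIntegral_le_lintegral _ _
    _ ≤ μ S * ENNReal.ofReal (Real.exp (b * c)) := by
        rw [mul_comm (μ S)]
        exact lintegral_indicator_const_le _ _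

lemma exists_le_withDensity_expDensity [TopologicalSpace α] [OpensMeasurableSpace α]
    {μ : Measure α} {S A : Set α} {g : α → ℝ} {c : ℝ} {x : α}
    (hS : MeasurableSet S) (hfin : μ S ≠ ⊤) (hpos : ∀ x ∈ S, ∀ W ∈ 𝓝 x, μ (W ∩ S) ≠ 0)
    (hg : ContinuousOn g S) (hA : MeasurableSet A) (hxA : x ∈ interior A) (hxS : x ∈ S)
    (hc : c < g x) :
    ∃ k : ℝ, ∀ b : ℝ, 0 ≤ b →
      ENNReal.ofReal (Real.exp (k + b * c)) ≤ μ.withDensity (expDensity S g b) A := by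
  have hev : {y | c < g y} ∈ 𝓝[S] x := (hg x hxS).eventually (lt_mem_nhds hc)
  obtain ⟨W, hW, hxW, hWS⟩ := mem_nhdsWithin.1 hev
  set V := (W ∩ interior A) ∩ S with hV
  have hVm : MeasurableSet V :=
    ((hW.measurableSet).inter isOpen_interior.measurableSet).inter hS
  have hV0 : μ V ≠ 0 :=
    hpos x hxS _ ((hW.inter isOpen_interior).mem_nhds ⟨hxW, hxA⟩)
  have hVt : μ V ≠ ⊤ := ne_top_of_le_ne_top hfin (measure_mono Set.inter_subset_right)
  obtain ⟨k, hk⟩ := ENNReal.exists_eq_ofReal_exp hV0 hVt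
  refine ⟨k, fun b hb => ?_⟩
  rw [Real.exp_add, ENNReal.ofReal_mul (Real.exp_pos _).le, ← hk, withDensity_apply _ hA,
    mul_comm, ← setLIntegral_const]
  calc ∫⁻ _ in V, ENNReal.ofReal (Real.exp (b * c)) ∂μ
      ≤ ∫⁻ y in V, expDensity S g b y ∂μ := by
        refine setLIntegral_mono' hVm fun y hy => ?_
        simp only [expDensity, if_pos hy.2]
        gcongr
        exact (hWS ⟨hy.1.1, hy.2⟩ : c < g y).le
    _ ≤ ∫⁻ y in A, expDensity S g b y ∂μ :=
        lintegral_mono_set fun y hy => interior_subset hy.1.2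

lemma tendsto_inv_mul_log_ofReal_exp {b : ℕ → ℝ} {a : ℝ}
    (hb : Tendsto (fun n : ℕ => b n / n) atTop (𝓝 a)) (k c : ℝ) :
    Tendsto (fun n : ℕ => (((n : ℝ)⁻¹ : ℝ) : EReal) *
      (ENNReal.ofReal (Real.exp (k + b n * c))).log) atTop (𝓝 ((a * c : ℝ) : EReal)) := by
  have h : Tendsto (fun n : ℕ => k / n + b n / n * c) atTop (𝓝 (0 + a * c)) :=
    (tendsto_const_div_atTop_nhds_zero_nat k).add (hb.mul_const c)
  rw [zero_add] at h
  refine ((continuous_coe_real_ereal.tendsto _).comp h).congr fun n => ?_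
  rw [ENNReal.log_ofReal_of_pos (Real.exp_pos _), Real.log_exp, ← EReal.coe_mul,
    Function.comp_apply]
  congr 1
  ring

lemma limsup_inv_mul_log_le {u : ℕ → ℝ≥0∞} {b : ℕ → ℝ} {a k c : ℝ}
    (hb : Tendsto (fun n : ℕ => b n / n) atTop (𝓝 a))
    (hu : ∀ᶠ n in atTop, u n ≤ ENNReal.ofReal (Real.exp (k + b n * c))) :
    limsup (fun n : ℕ => (((n : ℝ)⁻¹ : ℝ) : EReal) * (u n).log) atTop ≤ ((a * c : ℝ) : EReal) := by
  rw [← (tendsto_inv_mul_log_ofReal_exp hb k c).limsup_eq]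
  refine limsup_le_limsup ?_
  filter_upwards [hu] with n hn
  exact mul_le_mul_of_nonneg_left (ENNReal.log_monotone hn)
    (EReal.coe_nonneg.2 (by positivity))

lemma le_liminf_inv_mul_log {u : ℕ → ℝ≥0∞} {b : ℕ → ℝ} {a k c : ℝ}
    (hb : Tendsto (fun n : ℕ => b n / n) atTop (𝓝 a))
    (hu : ∀ᶠ n in atTop, ENNReal.ofReal (Real.exp (k + b n * c)) ≤ u n) :
    ((a * c : ℝ) : EReal) ≤ liminf (fun n : ℕ => (((n : ℝ)⁻¹ : ℝ) : EReal) * (u n).log) atTop := by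
  rw [← (tendsto_inv_mul_log_ofReal_exp hb k c).liminf_eq]
  refine liminf_le_liminf ?_
  filter_upwards [hu] with n hn
  exact mul_le_mul_of_nonneg_left (ENNReal.log_monotone hn)
    (EReal.coe_nonneg.2 (by positivity))

lemma EReal.le_coe_of_forall_pos_le_coe_add {x : EReal} {y : ℝ}
    (h : ∀ δ : ℝ, 0 < δ → x ≤ ((y + δ : ℝ) : EReal)) : x ≤ y := by
  have ht : Tendsto (fun δ : ℝ => ((y + δ : ℝ) : EReal)) (𝓝[>] 0) (𝓝 (y : EReal)) := by
    have : Continuous fun δ : ℝ => ((y + δ : ℝ) : EReal) :=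
      continuous_coe_real_ereal.comp (continuous_const.add continuous_id)
    simpa using (this.tendsto 0).mono_left nhdsWithin_le_nhds
  exact ge_of_tendsto ht (eventually_nhdsWithin_of_forall fun δ hδ => h δ hδ)

lemma EReal.coe_le_of_forall_pos_coe_sub_le {x : EReal} {y : ℝ}
    (h : ∀ δ : ℝ, 0 < δ → ((y - δ : ℝ) : EReal) ≤ x) : y ≤ x := by
  have ht : Tendsto (fun δ : ℝ => ((y - δ : ℝ) : EReal)) (𝓝[>] 0) (𝓝 (y : EReal)) := by
    have : Continuous fun δ : ℝ => ((y - δ : ℝ) : EReal) :=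
      continuous_coe_real_ereal.comp (continuous_const.sub continuous_id)
    simpa using (this.tendsto 0).mono_left nhdsWithin_le_nhds
  exact le_of_tendsto ht (eventually_nhdsWithin_of_forall fun δ hδ => h δ hδ)

/-- Laplace principle: the normalized measures with density `e^{b_n g}` on a set of finite
measure satisfy a large deviation principle when `b_n / n` converges to a positive limit. -/
theorem isLDP_mnormalize_expDensity [TopologicalSpace α] [T2Space α] [OpensMeasurableSpace α]
    {μ : Measure α} {S : Set α} {g : α → ℝ} {x₀ : α} {a : ℝ} {b : ℕ → ℝ}
    (hS : MeasurableSet S) (hfin : μ S ≠ ⊤) (hpos : ∀ x ∈ S, ∀ W ∈ 𝓝 x, μ (W ∩ S) ≠ 0)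
    (hg : ContinuousOn g S) (hx₀ : x₀ ∈ S) (hmax : ∀ x ∈ S, g x ≤ g x₀) (ha : 0 < a)
    (hb : Tendsto (fun n : ℕ => b n / n) atTop (𝓝 a))
    (hcomp : ∀ c : ℝ, IsCompact {x | x ∈ S ∧ c ≤ g x}) :
    IsLDP (fun n => mnormalize (μ.withDensity (expDensity S g (b n))))
      (fun x => if x ∈ S then ((a * (g x₀ - g x) : ℝ) : EReal) else ⊤) := by
  have hsub : ∀ c : ℝ, {x | (if x ∈ S then ((a * (g x₀ - g x) : ℝ) : EReal) else ⊤) ≤ (c : EReal)}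
      = {x | x ∈ S ∧ g x₀ - c / a ≤ g x} := by
    intro c
    ext x
    by_cases hx : x ∈ S
    · rw [Set.mem_ofPred_eq, Set.mem_ofPred_eq, if_pos hx, EReal.coe_le_coe_iff, and_iff_right hx]
      rw [← le_div_iff₀' ha, sub_le_comm]
    · simp [hx]
  have hb0 : ∀ᶠ n in atTop, 0 ≤ b n := by
    filter_upwards [hb.eventually (lt_mem_nhds ha), eventually_gt_atTop 0] with n hn hn0
    have : (0 : ℝ) < n := by exact_mod_cast hn0
    exact ((div_pos_iff_of_pos_right this).1 hn).le
  have hS0 : μ S ≠ 0 := by simpa using hpos x₀ hx₀ Set.univ univ_mem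
  obtain ⟨k, hk⟩ := ENNReal.exists_eq_ofReal_exp hS0 hfin
  have hup : ∀ {A : Set α} {c b : ℝ}, MeasurableSet A → 0 ≤ b → (∀ x ∈ A, x ∈ S → g x ≤ c) →
      μ.withDensity (expDensity S g b) A ≤ ENNReal.ofReal (Real.exp (k + b * c)) := by
    intro A c b hA hb hc
    rw [Real.exp_add, ENNReal.ofReal_mul (Real.exp_pos _).le, ← hk]
    exact withDensity_expDensity_le hA hb hc
  have hquot : ∀ s t : ℝ, (ENNReal.ofReal (Real.exp s))⁻¹ * ENNReal.ofReal (Real.exp t) =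
      ENNReal.ofReal (Real.exp (t - s)) := by
    intro s t
    rw [← ENNReal.ofReal_inv_of_pos (Real.exp_pos _), ← ENNReal.ofReal_mul (by positivity),
      ← Real.exp_neg, ← Real.exp_add]
    congr 2
    ring
  refine ⟨lowerSemicontinuous_iff_isClosed_preimage.2 fun y => ?_, fun c => ?_, fun A hA => ⟨?_, ?_⟩⟩
  · induction y with
    | bot =>
      convert isClosed_empty
      ext x
      simp only [Set.mem_preimage, Set.mem_Iic, le_bot_iff, Set.mem_empty_iff_false, iff_false]
      split_ifs
      · exact EReal.coe_ne_bot _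
      · exact top_ne_bot
    | coe c =>
      have := (hcomp (g x₀ - c / a)).isClosed
      rw [← hsub] at this
      exact this
    | top => simp
  · rw [hsub]
    exact hcomp _
  · refine EReal.neg_le_of_neg_le (le_iInf₂ fun x hx => ?_)
    by_cases hxS : x ∈ S
    swap
    · simp [hxS]
    simp only [if_pos hxS]
    refine EReal.neg_le_of_neg_le ?_
    rw [← EReal.coe_neg]
    refine EReal.coe_le_of_forall_pos_coe_sub_le fun δ hδ => ?_
    have hlt : g x - δ / a < g x := sub_lt_self _ (div_pos hδ ha)
    obtain ⟨k', hk'⟩ := exists_le_withDensity_expDensity hS hfin hpos hg hA hx hxS hlt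
    have := le_liminf_inv_mul_log (k := k' - k) (c := g x - δ / a - g x₀)
      (u := fun n => mnormalize (μ.withDensity (expDensity S g (b n))) A) hb ?_
    · refine le_trans (le_of_eq ?_) this
      congr 1
      field_simp
      ring
    · filter_upwards [hb0] with n hn
      have h1 := hup MeasurableSet.univ hn fun x _ hx => hmax x hx
      have h2 := hk' (b n) hn
      rw [mnormalize, Measure.smul_apply, smul_eq_mul]
      refine le_trans (le_of_eq ?_) (mul_le_mul' (ENNReal.inv_le_inv.2 h1) h2)
      rw [hquot]
      congr 2
      ring
  · refine EReal.le_neg_of_le_neg (EReal.ge_of_forall_gt_iff_ge.1 fun z hz => ?_)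
    refine EReal.le_neg_of_le_neg ?_
    rw [← EReal.coe_neg]
    have hzA : ∀ x ∈ A, x ∈ S → g x ≤ g x₀ - z / a := by
      intro x hx hxS
      have h := hz.le.trans (iInf₂_le x (subset_closure hx))
      simp only [if_pos hxS, EReal.coe_le_coe_iff] at h
      rw [le_sub_comm, div_le_iff₀' ha]
      exact h
    refine EReal.le_coe_of_forall_pos_le_coe_add fun δ hδ => ?_
    have hlt : g x₀ - δ / a < g x₀ := sub_lt_self _ (div_pos hδ ha)
    obtain ⟨k', hk'⟩ := exists_le_withDensity_expDensity hS hfin hpos hg MeasurableSet.univ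
      (x := x₀) (by simp) hx₀ hlt
    have := limsup_inv_mul_log_le (k := k - k') (c := δ / a - z / a)
      (u := fun n => mnormalize (μ.withDensity (expDensity S g (b n))) A) hb ?_
    · refine this.trans (le_of_eq ?_)
      congr 1
      field_simp
      ring
    · filter_upwards [hb0] with n hn
      have h1 := hup hA hn hzA
      have h2 := hk' (b n) hn
      rw [mnormalize, Measure.smul_apply, smul_eq_mul]
      refine (mul_le_mul' (ENNReal.inv_le_inv.2 h2) h1).trans (le_of_eq ?_)
      rw [hquot]
      congr 2
      ring

end LaplacePrinciple

section PosDef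

open scoped Matrix

variable {n : Type*} [Fintype n]

lemma Matrix.isClosed_setOf_posSemidef :
    IsClosed {A : Matrix n n ℂ | A.PosSemidef} := by
  simp only [Matrix.posSemidef_iff_dotProduct_mulVec, Set.ofPred_and, Set.ofPred_forall]
  refine IsClosed.inter (isClosed_eq (by fun_prop) continuous_id) (isClosed_iInter fun v => ?_)
  exact isClosed_le continuous_const (by fun_prop)

lemma Matrix.PosDef.eventually_posDef {X : Matrix n n ℂ} (hX : X.PosDef) :
    ∀ᶠ A in 𝓝 X, A.IsHermitian → A.PosDef := by
  have hK : IsCompact (Metric.sphere (0 : n → ℂ) 1) := isCompact_sphere _ _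
  have h : ∀ᶠ A in 𝓝 X, ∀ v ∈ Metric.sphere (0 : n → ℂ) 1, 0 < (star v ⬝ᵥ (A *ᵥ v)).re := by
    refine hK.eventually_forall_of_forall_eventually fun v hv => ?_
    have hc : Continuous fun z : Matrix n n ℂ × (n → ℂ) => (star z.2 ⬝ᵥ (z.1 *ᵥ z.2)).re := by
      fun_prop
    refine (hc.tendsto (X, v)).eventually (lt_mem_nhds (hX.re_dotProduct_pos ?_))
    rintro rfl
    simp at hv
  filter_upwards [h] with A hA hH
  refine Matrix.PosDef.of_dotProduct_mulVec_pos hH fun v hv => ?_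
  have hr : 0 < ‖v‖ := norm_pos_iff.2 hv
  have h1 := hA ((‖v‖⁻¹ : ℝ) • v) (by simp [norm_smul, hr.ne'])
  rw [Matrix.mulVec_smul, star_smul, smul_dotProduct, dotProduct_smul, star_trivial,
    Complex.smul_re, Complex.smul_re, smul_eq_mul, smul_eq_mul] at h1
  have h2 : 0 < (star v ⬝ᵥ (A *ᵥ v)).re := by
    have hi := inv_pos.2 hr
    exact (mul_pos_iff_of_pos_left hi).1 ((mul_pos_iff_of_pos_left hi).1 h1)
  refine Complex.pos_iff.2 ⟨h2, (hH.im_star_dotProduct_mulVec_self v).symm⟩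

variable [DecidableEq n]

lemma Matrix.PosSemidef.norm_apply_le_one {B : Matrix n n ℂ} (hB : B.PosSemidef)
    (hB' : (1 - B).PosSemidef) (i j : n) : ‖B i j‖ ≤ 1 := by
  have hps : (B - B * B).PosSemidef := by
    have h1 := hB'.conjTranspose_mul_mul_same B
    have h2 := hB.conjTranspose_mul_mul_same (1 - B)
    rw [hB.isHermitian.eq] at h1
    rw [hB'.isHermitian.eq] at h2
    convert h1.add h2 using 1
    noncomm_ring
  have hsum : (B * B) i i = ((∑ k, ‖B i k‖ ^ 2 : ℝ) : ℂ) := by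
    rw [Matrix.mul_apply]
    push_cast
    refine Finset.sum_congr rfl fun k _ => ?_
    rw [← hB.isHermitian.apply k i, ← Complex.mul_conj']
    rfl
  have h1 : (∑ k, ‖B i k‖ ^ 2 : ℝ) ≤ (B i i).re := by
    have := (Complex.nonneg_iff.1 (hps.diag_nonneg (i := i))).1
    rw [Matrix.sub_apply, hsum, Complex.sub_re, Complex.ofReal_re] at this
    linarith
  have h2 : (B i i).re ≤ 1 := by
    have := (Complex.nonneg_iff.1 (hB'.diag_nonneg (i := i))).1
    simp at this
    linarith
  have h3 : ‖B i j‖ ^ 2 ≤ ∑ k, ‖B i k‖ ^ 2 :=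
    Finset.single_le_sum (f := fun k => ‖B i k‖ ^ 2) (fun _ _ => by positivity)
      (Finset.mem_univ j)
  nlinarith [norm_nonneg (B i j)]

lemma Matrix.isCompact_posSemidef_one_sub_posSemidef :
    IsCompact {B : Matrix n n ℂ | B.PosSemidef ∧ (1 - B).PosSemidef} := by
  have hK : IsCompact (Set.univ.pi fun _ : n => Set.univ.pi fun _ : n =>
      Metric.closedBall (0 : ℂ) 1) :=
    isCompact_univ_pi fun _ => isCompact_univ_pi fun _ => isCompact_closedBall _ _
  refine hK.of_isClosed_subset (Matrix.isClosed_setOf_posSemidef.inter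
    (Matrix.isClosed_setOf_posSemidef.preimage (continuous_const.sub continuous_id))) ?_
  rintro B ⟨h1, h2⟩ i - j -
  simpa using h1.norm_apply_le_one h2 i j

lemma Matrix.det_sub_sq (B : Matrix n n ℂ) : (B - B ^ 2).det = B.det * (1 - B).det := by
  rw [← Matrix.det_mul, mul_sub, mul_one, sq]

lemma Matrix.PosDef.ofReal_re_det {B : Matrix n n ℂ} (hB : B.PosDef) :
    ((B.det.re : ℝ) : ℂ) = B.det :=
  Complex.ext rfl (Complex.pos_iff.1 hB.det_pos).2

lemma Matrix.PosDef.re_det_pos {B : Matrix n n ℂ} (hB : B.PosDef) : 0 < B.det.re :=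
  (Complex.pos_iff.1 hB.det_pos).1

lemma Matrix.PosDef.re_det_sub_sq {B : Matrix n n ℂ} (hB : B.PosDef) (hB' : (1 - B).PosDef) :
    (B - B ^ 2).det.re = B.det.re * (1 - B).det.re := by
  rw [Matrix.det_sub_sq, ← hB.ofReal_re_det, ← hB'.ofReal_re_det]
  simp

lemma Matrix.PosDef.re_det_sub_sq_le {B : Matrix n n ℂ} (hB : B.PosDef)
    (hB' : (1 - B).PosDef) : (B - B ^ 2).det.re ≤ (1 / 4) ^ Fintype.card n := by
  set l := hB.isHermitian.eigenvalues with hl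
  have h1 : (1 - B).det = ((∏ i, (1 - l i) : ℝ) : ℂ) := by
    have h := congrArg (Polynomial.eval 1) hB.isHermitian.charpoly_eq
    rw [Matrix.eval_charpoly, Polynomial.eval_prod] at h
    simpa using h
  have hle : ∀ i, l i ≤ 1 := by
    intro i
    set v : n → ℂ := (hB.isHermitian.eigenvectorBasis i).ofLp with hv
    have hv0 : v ≠ 0 :=
      (WithLp.ofLp_eq_zero 2).ne.2 (hB.isHermitian.eigenvectorBasis.orthonormal.ne_zero i)
    have h : 0 < (star v ⬝ᵥ ((1 - B) *ᵥ v)).re := hB'.re_dotProduct_pos hv0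
    have hw : 0 ≤ (star v ⬝ᵥ v).re := (Complex.nonneg_iff.1 (dotProduct_star_self_nonneg v)).1
    rw [Matrix.sub_mulVec, hv, hB.isHermitian.mulVec_eigenvectorBasis, ← hv, Matrix.one_mulVec,
      dotProduct_sub, dotProduct_smul, Complex.sub_re, Complex.smul_re, smul_eq_mul,
      ← one_sub_mul] at h
    exact (sub_pos.1 (pos_of_mul_pos_left h hw)).le
  have h2 : (B - B ^ 2).det = ((∏ i, (l i * (1 - l i)) : ℝ) : ℂ) := by
    rw [Matrix.det_sub_sq, h1, hB.isHermitian.det_eq_prod_eigenvalues, Finset.prod_mul_distrib]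
    simp [hl]
  rw [h2, Complex.ofReal_re]
  calc ∏ i, (l i * (1 - l i)) ≤ ∏ _i : n, (1 / 4 : ℝ) :=
        Finset.prod_le_prod (fun i _ => mul_nonneg (hB.eigenvalues_pos i).le
          (sub_nonneg.2 (hle i))) fun i _ => by nlinarith [sq_nonneg (l i - 1 / 2)]
    _ = (1 / 4) ^ Fintype.card n := by simp

end PosDef

section MatrixBeta

variable {p : ℕ}

/-- The set of Hermitian matrices `0 < X < I`. -/
def betaDomain (p : ℕ) : Set (Matrix (Fin p) (Fin p) ℂ) :=
  {X | X.PosDef ∧ ((1 : Matrix (Fin p) (Fin p) ℂ) - X).PosDef}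

instance matrixBorelSpace (p : ℕ) : BorelSpace (Matrix (Fin p) (Fin p) ℂ) :=
  inferInstanceAs (BorelSpace (Fin p → Fin p → ℂ))

lemma betaDomain_eq (p : ℕ) : betaDomain p =
    {X | X.PosSemidef ∧ (1 - X).PosSemidef} ∩ {X | X.det ≠ 0 ∧ (1 - X).det ≠ 0} := by
  ext X
  refine ⟨fun h => ⟨⟨h.1.posSemidef, h.2.posSemidef⟩, h.1.det_pos.ne', h.2.det_pos.ne'⟩,
    fun h => ⟨h.1.1.posDef_iff_det_ne_zero.2 h.2.1, h.1.2.posDef_iff_det_ne_zero.2 h.2.2⟩⟩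

lemma measurableSet_betaDomain : MeasurableSet (betaDomain p) := by
  rw [betaDomain_eq]
  refine Matrix.isCompact_posSemidef_one_sub_posSemidef.isClosed.measurableSet.inter
    (IsOpen.measurableSet ?_)
  exact (isOpen_ne_fun (by fun_prop) continuous_const).inter
    (isOpen_ne_fun (by fun_prop) continuous_const)

lemma continuous_hermMk : Continuous (hermMk p) := by
  refine continuous_matrix fun i j => ?_
  simp only [hermMk, Matrix.of_apply]
  split_ifs
  · fun_prop
  · fun_prop
  · fun_prop

lemma isHermitian_hermMk (x : (Fin p → ℝ) × ({q : Fin p × Fin p // q.1 < q.2} → ℂ)) :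
    (hermMk p x).IsHermitian := by
  refine Matrix.IsHermitian.ext fun i j => ?_
  simp only [hermMk, Matrix.of_apply]
  rcases lt_trichotomy i j with h | rfl | h
  · simp [h, h.not_gt]
  · simp
  · simp [h, h.not_gt]

lemma exists_hermMk_eq {X : Matrix (Fin p) (Fin p) ℂ} (hX : X.IsHermitian) :
    ∃ x, hermMk p x = X := by
  refine ⟨(fun i => (X i i).re, fun q => X q.1.1 q.1.2), ?_⟩
  ext i j
  simp only [hermMk, Matrix.of_apply]
  rcases lt_trichotomy i j with h | rfl | h
  · simp [h]
  · simpa using hX.coe_re_apply_self i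
  · simpa [h, h.not_gt] using hX.apply i j

lemma hermLebesgue_betaDomain_ne_top : hermLebesgue p (betaDomain p) ≠ ⊤ := by
  rw [hermLebesgue, Measure.map_apply continuous_hermMk.measurable measurableSet_betaDomain]
  refine ne_top_of_le_ne_top (Metric.isBounded_closedBall (x := 0) (r := 1)).measure_lt_top.ne
    (measure_mono fun x hx => ?_)
  have h := hx.1.posSemidef.norm_apply_le_one hx.2.posSemidef
  rw [mem_closedBall_zero_iff, Prod.norm_def, sup_le_iff, pi_norm_le_iff_of_nonneg zero_le_one,
    pi_norm_le_iff_of_nonneg zero_le_one]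
  refine ⟨fun i => ?_, fun q => ?_⟩
  · simpa [hermMk] using h i i
  · simpa [hermMk, q.2] using h q.1.1 q.1.2

lemma hermLebesgue_inter_betaDomain_ne_zero {X : Matrix (Fin p) (Fin p) ℂ}
    (hX : X ∈ betaDomain p) {W : Set (Matrix (Fin p) (Fin p) ℂ)} (hW : W ∈ 𝓝 X) :
    hermLebesgue p (W ∩ betaDomain p) ≠ 0 := by
  obtain ⟨x, rfl⟩ := exists_hermMk_eq hX.1.isHermitian
  have hpre : hermMk p ⁻¹' (W ∩ betaDomain p) ∈ 𝓝 x := by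
    have h2 : Tendsto (fun y => 1 - hermMk p y) (𝓝 x) (𝓝 (1 - hermMk p x)) :=
      (continuous_const.sub continuous_hermMk).tendsto x
    filter_upwards [continuous_hermMk.tendsto x hW,
      (continuous_hermMk.tendsto x).eventually hX.1.eventually_posDef,
      h2.eventually hX.2.eventually_posDef] with y hyW hy1 hy2
    exact ⟨hyW, hy1 (isHermitian_hermMk y),
      hy2 (Matrix.isHermitian_one.sub (isHermitian_hermMk y))⟩
  have hpos := Measure.measure_pos_of_mem_nhds volume hpre
  exact (hpos.trans_le (Measure.le_map_apply continuous_hermMk.aemeasurable _)).ne'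

lemma matrixBeta_eq_mnormalize_expDensity (α : ℝ) :
    matrixBeta p α α = mnormalize ((hermLebesgue p).withDensity
      (expDensity (betaDomain p) (fun X => Real.log (X - X ^ 2).det.re) (α - p))) := by
  rw [matrixBeta]
  congr 2
  ext X
  by_cases hX : X ∈ betaDomain p
  · rw [expDensity, if_pos hX]
    refine (if_pos hX).trans ?_
    have h1 := hX.1.re_det_pos
    have h2 := hX.2.re_det_pos
    congr 1
    rw [hX.1.re_det_sub_sq hX.2, mul_comm (α - p), ← Real.rpow_def_of_pos (mul_pos h1 h2),
      Real.mul_rpow h1.le h2.le]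
    rfl
  · rw [expDensity, if_neg hX]
    exact if_neg hX

lemma isCompact_betaDomain_inter_le_log_det (c : ℝ) :
    IsCompact {X | X ∈ betaDomain p ∧ c ≤ Real.log (X - X ^ 2).det.re} := by
  have : {X | X ∈ betaDomain p ∧ c ≤ Real.log (X - X ^ 2).det.re} =
      {X | X.PosSemidef ∧ (1 - X).PosSemidef} ∩ {X | Real.exp c ≤ (X - X ^ 2).det.re} := by
    ext X
    constructor
    · rintro ⟨hX, hc⟩
      refine ⟨⟨hX.1.posSemidef, hX.2.posSemidef⟩, ?_⟩
      rwa [Set.mem_ofPred_eq, ← Real.le_log_iff_exp_le]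
      rw [hX.1.re_det_sub_sq hX.2]
      exact mul_pos hX.1.re_det_pos hX.2.re_det_pos
    · rintro ⟨hX, hc⟩
      have hpos : 0 < (X - X ^ 2).det.re := (Real.exp_pos c).trans_le hc
      refine ⟨?_, (Real.le_log_iff_exp_le hpos).2 hc⟩
      rw [betaDomain_eq]
      refine ⟨hX, ?_⟩
      rw [Set.mem_ofPred_eq, ← mul_ne_zero_iff, ← Matrix.det_sub_sq]
      intro h0
      simp [h0] at hpos
  rw [this]
  exact Matrix.isCompact_posSemidef_one_sub_posSemidef.inter_right
    (isClosed_le continuous_const (by fun_prop))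

lemma half_mem_betaDomain : ((1 / 2 : ℂ) • 1 : Matrix (Fin p) (Fin p) ℂ) ∈ betaDomain p := by
  have h : ((1 / 2 : ℂ) • 1 : Matrix (Fin p) (Fin p) ℂ).PosDef :=
    Matrix.PosDef.one.smul (by rw [Complex.pos_iff]; norm_num)
  refine ⟨h, ?_⟩
  convert h using 1
  rw [sub_eq_iff_eq_add, ← add_smul]
  norm_num

lemma re_det_half_sub_sq :
    ((1 / 2 : ℂ) • 1 - ((1 / 2 : ℂ) • 1) ^ 2 : Matrix (Fin p) (Fin p) ℂ).det.re
      = (1 / 4) ^ p := by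
  have : ((1 / 2 : ℂ) • 1 - ((1 / 2 : ℂ) • 1) ^ 2 : Matrix (Fin p) (Fin p) ℂ)
      = ((1 / 4 : ℝ) : ℂ) • 1 := by
    rw [smul_pow, one_pow, ← sub_smul]
    norm_num
  rw [this, Matrix.det_smul, Matrix.det_one, mul_one, Fintype.card_fin, ← Complex.ofReal_pow,
    Complex.ofReal_re]

end MatrixBeta

/-- LDP for `Beta_p(a_n, a_n)` with `a_n = a₀ + a n`: speed `n` and good rate function
`I(B) = -a log det(B - B²) - 2ap log 2` for `0 < B < I`, `+∞` otherwise. -/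
theorem matrixBeta_symm_LDP (p : ℕ) (a₀ a : ℝ) (ha₀ : 0 < a₀) (ha : 0 < a) :
    IsLDP (fun n => matrixBeta p (a₀ + a * n) (a₀ + a * n))
      (fun B =>
        if B.PosDef ∧ ((1 : Matrix (Fin p) (Fin p) ℂ) - B).PosDef then
          (((-a) * Real.log ((B - B ^ 2).det.re) - 2 * a * p * Real.log 2 : ℝ) : EReal)
        else ⊤) := by
  have hlog : Real.log ((1 / 4 : ℝ) ^ p) = -(2 * p * Real.log 2) := by
    rw [Real.log_pow, one_div, Real.log_inv, show (4 : ℝ) = 2 ^ 2 by norm_num, Real.log_pow]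
    push_cast
    ring
  have hmem : ∀ X ∈ betaDomain p, 0 < (X - X ^ 2).det.re := fun X hX => by
    rw [hX.1.re_det_sub_sq hX.2]
    exact mul_pos hX.1.re_det_pos hX.2.re_det_pos
  have hcont : Continuous fun X : Matrix (Fin p) (Fin p) ℂ => (X - X ^ 2).det.re := by fun_prop
  have hlim : Tendsto (fun n : ℕ => (a₀ + a * n - p) / n) atTop (𝓝 a) := by
    have h := (tendsto_const_div_atTop_nhds_zero_nat (a₀ - p)).add_const a
    rw [zero_add] at h
    refine h.congr' ?_
    filter_upwards [eventually_gt_atTop 0] with n hn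
    have : (n : ℝ) ≠ 0 := by exact_mod_cast hn.ne'
    field_simp
    ring
  have key := isLDP_mnormalize_expDensity (μ := hermLebesgue p)
    (g := fun X => Real.log (X - X ^ 2).det.re) measurableSet_betaDomain
    hermLebesgue_betaDomain_ne_top (fun X hX W hW => hermLebesgue_inter_betaDomain_ne_zero hX hW)
    (hcont.continuousOn.log fun X hX => (hmem X hX).ne') half_mem_betaDomain
    (fun X hX => Real.log_le_log (hmem X hX) ?_) ha hlim isCompact_betaDomain_inter_le_log_det
  · simp only [matrixBeta_eq_mnormalize_expDensity]
    convert key using 2 with X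
    refine if_congr Iff.rfl ?_ rfl
    rw [re_det_half_sub_sq, hlog]
    congr 1
    ring
  · rw [re_det_half_sub_sq]
    simpa using hX.1.re_det_sub_sq_le hX.2
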